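/- Let A, B, X, Y be finite sets and let f : A × B × Fin 2 × X × Y × Fin 3 → ℝ. If for every quantum assemblage (σ_{ab|xy}) of 2×2 matrices the real part of ∑_{a,b,d,x,y,w} f(a,b,d,x,y,w)·Tr(Π_{d,w}·σ_{ab|xy}) is nonnegative, then also for every quantum assemblage (σ_{ab|xy}) of 2×2 matrices the real part of ∑_{a,b,d,x,y,w} f(a,b,d,x,y,w)·Tr(Π_{d,w}ᵀ·σ_{ab|xy}) is nonnegative, where Π_{d,w}ᵀ is the transpose of Π_{d,w}. -/

import Mathlib

open Matrix Kronecker Complex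
open scoped BigOperators ComplexOrder

noncomputable def Pauli : Fin 3 → Matrix (Fin 2) (Fin 2) ℂ :=
  ![!![0, 1; 1, 0], !![0, -Complex.I; Complex.I, 0], !![1, 0; 0, -1]]

noncomputable def PProj (d : Fin 2) (w : Fin 3) : Matrix (Fin 2) (Fin 2) ℂ :=
  ((1 : ℂ) / 2) • ((1 : Matrix (Fin 2) (Fin 2) ℂ) + ((-1 : ℂ) ^ (d : ℕ)) • Pauli w)

noncomputable def E00 : Matrix (Fin 2) (Fin 2) ℂ := !![1, 0; 0, 0]
noncomputable def E11 : Matrix (Fin 2) (Fin 2) ℂ := !![0, 0; 0, 1]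

def IsNSAssemblage {D W ι : Type*} [Fintype D] [Fintype ι]
    (σ : D → W → Matrix ι ι ℂ) : Prop :=
  (∀ d w, (σ d w).PosSemidef) ∧
  (∀ w w', ∑ d, σ d w = ∑ d, σ d w') ∧
  (∀ w, (∑ d, σ d w).trace = 1)

def IsExtremalNSAssemblage {D W ι : Type*} [Fintype D] [Fintype ι]
    (σ : D → W → Matrix ι ι ℂ) : Prop :=
  IsNSAssemblage σ ∧
  ∀ (t : ℝ) (τ τ' : D → W → Matrix ι ι ℂ), 0 < t → t < 1 →
    IsNSAssemblage τ → IsNSAssemblage τ' →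
    (∀ d w, σ d w = (t : ℂ) • τ d w + ((1 - t : ℝ) : ℂ) • τ' d w) →
    ∀ d w, τ d w = σ d w ∧ τ' d w = σ d w

noncomputable def ptrace1 {α β : Type*} [Fintype α] (X : Matrix (α × β) (α × β) ℂ) :
    Matrix β β ℂ :=
  Matrix.of fun i j => ∑ p : α, X (p, i) (p, j)

noncomputable def ptrace2 {α β : Type*} [Fintype β] (X : Matrix (α × β) (α × β) ℂ) :
    Matrix α α ℂ :=
  Matrix.of fun i j => ∑ p : β, X (i, p) (j, p)

noncomputable def ptrace12 {α β γ : Type*} [Fintype α] [Fintype β]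
    (X : Matrix (α × β × γ) (α × β × γ) ℂ) : Matrix γ γ ℂ :=
  Matrix.of fun i j => ∑ p : α, ∑ q : β, X (p, q, i) (p, q, j)

def IsQuantumAssemblage {A B X Y ι : Type*} [Fintype A] [Fintype B]
    [Fintype ι] [DecidableEq ι]
    (σ : A → B → X → Y → Matrix ι ι ℂ) : Prop :=
  ∃ (nA nB : ℕ)
    (ρ : Matrix (Fin nA × Fin nB × ι) (Fin nA × Fin nB × ι) ℂ)
    (M : A → X → Matrix (Fin nA) (Fin nA) ℂ)
    (N : B → Y → Matrix (Fin nB) (Fin nB) ℂ),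
    ρ.PosSemidef ∧ ρ.trace = 1 ∧
    (∀ a x, (M a x).PosSemidef) ∧ (∀ x, ∑ a, M a x = 1) ∧
    (∀ b y, (N b y).PosSemidef) ∧ (∀ y, ∑ b, N b y = 1) ∧
    (∀ a b x y, σ a b x y =
      ptrace12 ((M a x ⊗ₖ (N b y ⊗ₖ (1 : Matrix ι ι ℂ))) * ρ))

theorem ptrace12_kronecker_one_mul_comm {α β γ : Type*} [Fintype α] [Fintype β] [Fintype γ]
    [DecidableEq γ] (P : Matrix α α ℂ) (Q : Matrix β β ℂ)
    (R : Matrix (α × β × γ) (α × β × γ) ℂ) :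
    ptrace12 ((P ⊗ₖ (Q ⊗ₖ (1 : Matrix γ γ ℂ))) * R) =
      ptrace12 (R * (P ⊗ₖ (Q ⊗ₖ (1 : Matrix γ γ ℂ)))) := by
  ext i j
  simp only [ptrace12, Matrix.of_apply, Matrix.mul_apply, Fintype.sum_prod_type,
    Matrix.kroneckerMap_apply, Matrix.one_apply, mul_ite, mul_one, mul_zero, ite_mul, zero_mul,
    Finset.sum_ite_eq, Finset.sum_ite_eq', Finset.mem_univ, if_true]
  have swap := Finset.sum_comm (s := Finset.univ) (t := Finset.univ)
    (f := fun u v : α × β => P u.1 v.1 * Q u.2 v.2 * R (v.1, v.2, i) (u.1, u.2, j))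
  simp only [Fintype.sum_prod_type] at swap
  rw [swap]
  simp only [mul_comm]

theorem ptrace12_transpose {α β γ : Type*} [Fintype α] [Fintype β]
    (R : Matrix (α × β × γ) (α × β × γ) ℂ) : (ptrace12 R)ᵀ = ptrace12 Rᵀ := rfl

theorem IsQuantumAssemblage.transpose {A B X Y ι : Type*} [Fintype A] [Fintype B]
    [Fintype ι] [DecidableEq ι] {σ : A → B → X → Y → Matrix ι ι ℂ}
    (hσ : IsQuantumAssemblage σ) : IsQuantumAssemblage fun a b x y => (σ a b x y)ᵀ := by
  obtain ⟨nA, nB, ρ, M, N, hρ, htr, hM, hM1, hN, hN1, h⟩ := hσ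
  refine ⟨nA, nB, ρᵀ, fun a x => (M a x)ᵀ, fun b y => (N b y)ᵀ, hρ.transpose,
    by rw [Matrix.trace_transpose, htr], fun a x => (hM a x).transpose, fun x => ?_,
    fun b y => (hN b y).transpose, fun y => ?_, fun a b x y => ?_⟩
  · rw [← Matrix.transpose_sum, hM1, Matrix.transpose_one]
  · rw [← Matrix.transpose_sum, hN1, Matrix.transpose_one]
  · dsimp only
    rw [h, ptrace12_transpose, Matrix.transpose_mul, ptrace12_kronecker_one_mul_comm,
      ← Matrix.kroneckerMap_transpose, ← Matrix.kroneckerMap_transpose, Matrix.transpose_one]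

theorem stmt13 {A B X Y : Type*} [Fintype A] [Fintype B] [Fintype X] [Fintype Y]
    (f : A × B × Fin 2 × X × Y × Fin 3 → ℝ)
    (hpos : ∀ σ : A → B → X → Y → Matrix (Fin 2) (Fin 2) ℂ, IsQuantumAssemblage σ →
      0 ≤ (∑ a, ∑ b, ∑ d, ∑ x, ∑ y, ∑ w,
        (f (a, b, d, x, y, w) : ℂ) * (PProj d w * σ a b x y).trace).re) :
    ∀ σ : A → B → X → Y → Matrix (Fin 2) (Fin 2) ℂ, IsQuantumAssemblage σ →
      0 ≤ (∑ a, ∑ b, ∑ d, ∑ x, ∑ y, ∑ w,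
        (f (a, b, d, x, y, w) : ℂ) * ((PProj d w)ᵀ * σ a b x y).trace).re := by
  intro σ hσ
  have trace_eq (P S : Matrix (Fin 2) (Fin 2) ℂ) : (Pᵀ * S).trace = (P * Sᵀ).trace := by
    rw [← Matrix.trace_transpose, Matrix.transpose_mul, Matrix.transpose_transpose,
      Matrix.trace_mul_comm]
  simpa only [trace_eq] using hpos _ hσ.transpose
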